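/- Let (Ω, F, P) be a probability space, let e : Ω → ℝⁿ, v : Ω → ℝᵐ, η : Ω → ℝᵐ, and d : Ω → ℝᵖ be integrable random vectors with E[d] = 0 and E[d·dᵀ] = E_d, and suppose d is independent of the triple (e, v, η). Let C be an m×n real matrix, B an n×p real matrix, and γ ∈ {0,1}. Define ε = C·B·d + η and r = C·e + v − (1 − γ)·ε. Then E[r·dᵀ] = (γ − 1)·C·B·E_d. -/

import Mathlib

open MeasureTheory ProbabilityTheory in
/-- under the CDW scheme, with watermark `d` independent of `(e, v, η)`,
`E[d] = 0`, `E[d·dᵀ] = E_d`, untransmitted innovation `ε = C·B·d + η` and residual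
`r = C·e + v − (1−γ)·ε` for a triggering value `γ ∈ {0,1}`, the cross covariance is
`E[r·dᵀ] = (γ − 1)·C·B·E_d`. -/
theorem stmt13 {Ω : Type*} [MeasurableSpace Ω] (μ : Measure Ω) [IsProbabilityMeasure μ]
    {n m p : ℕ} (e : Ω → (Fin n → ℝ)) (v η : Ω → (Fin m → ℝ)) (d : Ω → (Fin p → ℝ))
    (he1 : ∀ i, Integrable (fun ω => e ω i) μ)
    (hv1 : ∀ j, Integrable (fun ω => v ω j) μ)
    (hη1 : ∀ j, Integrable (fun ω => η ω j) μ)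
    (hd1 : ∀ j, Integrable (fun ω => d ω j) μ)
    (hem : Measurable e) (hvm : Measurable v) (hηm : Measurable η) (hdm : Measurable d)
    (hdmean : ∫ ω, d ω ∂μ = 0)
    (Ed : Matrix (Fin p) (Fin p) ℝ)
    (hdd : ∀ i j, Integrable (fun ω => d ω i * d ω j) μ)
    (hEd : (Matrix.of fun i j => ∫ ω, d ω i * d ω j ∂μ) = Ed)
    (hindep : IndepFun d (fun ω => (e ω, v ω, η ω)) μ)
    (C : Matrix (Fin m) (Fin n) ℝ) (B : Matrix (Fin n) (Fin p) ℝ)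
    (γ : ℝ) (hγ : γ = 0 ∨ γ = 1)
    (ε : Ω → (Fin m → ℝ)) (hε : ∀ ω, ε ω = (C * B).mulVec (d ω) + η ω)
    (r : Ω → (Fin m → ℝ))
    (hr : ∀ ω, r ω = C.mulVec (e ω) + v ω - (1 - γ) • ε ω) :
    (Matrix.of fun i j => ∫ ω, r ω i * d ω j ∂μ) = (γ - 1) • (C * B * Ed) := by
  have hdmean_apply (j : Fin p) : ∫ ω, d ω j ∂μ = 0 := by
    rw [← eval_integral hd1 j, hdmean, Pi.zero_apply]
  subst hEd
  ext i j
  let g : (Fin n → ℝ) × (Fin m → ℝ) × (Fin m → ℝ) → ℝ :=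
    fun x => ∑ k, C i k * x.1 k + x.2.1 i - (1 - γ) * x.2.2 i
  have hg : Measurable g := by fun_prop
  have hind : IndepFun (fun ω => g (e ω, v ω, η ω)) (fun ω => d ω j) μ :=
    (hindep.comp (measurable_pi_apply j) hg).symm
  have hgi : Integrable (fun ω => g (e ω, v ω, η ω)) μ :=
    ((integrable_finsetSum _ fun k _ => (he1 k).const_mul _).add (hv1 i)).sub
      ((hη1 i).const_mul _)
  have hgd : Integrable (fun ω => g (e ω, v ω, η ω) * d ω j) μ :=
    hind.integrable_mul hgi (hd1 j)
  have hgd0 : ∫ ω, g (e ω, v ω, η ω) * d ω j ∂μ = 0 := by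
    rw [hind.integral_fun_mul_eq_mul_integral hgi.aestronglyMeasurable
      (hd1 j).aestronglyMeasurable, hdmean_apply, mul_zero]
  have hdecomp (ω : Ω) : r ω i * d ω j =
      g (e ω, v ω, η ω) * d ω j + (γ - 1) * ∑ k, (C * B) i k * (d ω k * d ω j) := by
    simp only [hr, hε, g, Pi.add_apply, Pi.sub_apply, Pi.smul_apply, smul_eq_mul,
      Matrix.mulVec, dotProduct, ← mul_assoc ((C * B) i _), ← Finset.sum_mul]
    ring
  simp only [Matrix.of_apply, Matrix.smul_apply, smul_eq_mul, Matrix.mul_apply (M := C * B),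
    hdecomp]
  rw [integral_add hgd
    ((integrable_finsetSum _ fun k _ => (hdd k j).const_mul _).const_mul _), hgd0, zero_add,
    integral_const_mul, integral_finsetSum _ fun k _ => (hdd k j).const_mul _]
  simp only [integral_const_mul]
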